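/- Let N = (B,E,F) be a locally finite, K-dense causal net with X = B ∪ E, and let τ be a B-cut of N. Then the join of the closed sets {b}'' for b ∈ τ is the whole carrier: (⋃_{b ∈ τ} {b}'')'' = X. -/

import Mathlib

/-- A causal net `N = (B, E, F)`: conditions `B` and events `E` are disjoint
countable sets covering the carrier, `F ⊆ (B × E) ∪ (E × B)` is the flow
relation, every element is in `dom F ∪ ran F`, every condition has at most one
`F`-predecessor and at most one `F`-successor, and `F⁺` is irreflexive. -/
structure CausalNet (α : Type*) where
  B : Set α
  E : Set α
  F : α → α → Prop
  countable_B : B.Countable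
  countable_E : E.Countable
  disjoint_BE : Disjoint B E
  cover : B ∪ E = Set.univ
  bipartite : ∀ x y, F x y → (x ∈ B ∧ y ∈ E) ∨ (x ∈ E ∧ y ∈ B)
  no_isolated : ∀ x, (∃ y, F x y) ∨ (∃ y, F y x)
  pred_subsingleton : ∀ b ∈ B, {e | F e b}.Subsingleton
  succ_subsingleton : ∀ b ∈ B, {e | F b e}.Subsingleton
  acyclic : ∀ x, ¬ Relation.TransGen F x x

namespace CausalNet

variable {α : Type*} (N : CausalNet α)

/-- The causal order `⊑ = F*` (reflexive-transitive closure of `F`). -/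
def le (x y : α) : Prop := Relation.ReflTransGen N.F x y

/-- `li = ⊑ ∪ ⊒`: causal relatedness. -/
def li (x y : α) : Prop := N.le x y ∨ N.le y x

/-- `co = (X × X) \ li`: concurrency (causal independence). -/
def co (x y : α) : Prop := ¬ N.li x y

/-- `A' = {x | ∀ y ∈ A, x co y}`, the orthocomplement of `A`. -/
def prime (A : Set α) : Set α := {x | ∀ y ∈ A, N.co x y}

/-- `A` is closed iff `A = A''`. -/
def Closed (A : Set α) : Prop := A = N.prime (N.prime A)

/-- A line is a maximal clique of `li`. -/
def IsLine (l : Set α) : Prop :=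
  l.Pairwise N.li ∧ ∀ m : Set α, m.Pairwise N.li → l ⊆ m → m = l

/-- A cut is a maximal clique of `co ∪ id`, i.e. a maximal antichain. -/
def IsCut (c : Set α) : Prop :=
  c.Pairwise N.co ∧ ∀ m : Set α, m.Pairwise N.co → c ⊆ m → m = c

/-- K-density: every cut meets every line. -/
def KDense : Prop :=
  ∀ c l : Set α, N.IsCut c → N.IsLine l → (c ∩ l).Nonempty

/-- The interval `[x, y] = {z | x ⊑ z ⊑ y}`. -/
def interval (x y : α) : Set α := {z | N.le x z ∧ N.le z y}

/-- Local finiteness: intervals are finite and every element has finitely many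
immediate `F`-predecessors and immediate `F`-successors. -/
def LocallyFinite : Prop :=
  (∀ x y, (N.interval x y).Finite) ∧
  (∀ x, {y | N.F y x}.Finite) ∧ (∀ x, {y | N.F x y}.Finite)

/-- A B-cut of a subset `S`: a maximal antichain of `(S, ⊑)` consisting only of
conditions. -/
def IsBCutOf (S τ : Set α) : Prop :=
  τ ⊆ S ∧ τ ⊆ N.B ∧ τ.Pairwise N.co ∧
  ∀ m : Set α, m ⊆ S → m.Pairwise N.co → τ ⊆ m → m = τ

/-- Preconditions `•e` of an event. -/
def pre (e : α) : Set α := {b | N.F b e}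

/-- Postconditions `e•` of an event. -/
def post (e : α) : Set α := {b | N.F e b}

/-- Causally closed sets (Definition of `CC(N)`). -/
def CausallyClosed (C : Set α) : Prop :=
  (∀ e ∈ N.E, N.pre e ⊆ C → e ∈ C) ∧
  (∀ e ∈ N.E, N.post e ⊆ C → e ∈ C) ∧
  (∀ e ∈ N.E, e ∈ C → N.pre e ∪ N.post e ⊆ C) ∧
  (∀ x ∈ C, ∀ y ∈ C, N.li x y → N.interval x y ⊆ C)

end CausalNet

namespace CausalNet

theorem co_symm {α : Type*} (N : CausalNet α) {x y : α} (h : N.co x y) : N.co y x :=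
  fun hl => h hl.symm

theorem not_co_self {α : Type*} (N : CausalNet α) (x : α) : ¬ N.co x x :=
  fun h => h (Or.inl Relation.ReflTransGen.refl)

theorem subset_prime_prime {α : Type*} (N : CausalNet α) (A : Set α) :
    A ⊆ N.prime (N.prime A) :=
  fun x hx _ hy => N.co_symm (hy x hx)

theorem prime_anti {α : Type*} (N : CausalNet α) {A C : Set α} (h : A ⊆ C) :
    N.prime C ⊆ N.prime A :=
  fun _ hx y hy => hx y (h hy)

theorem IsCut.prime_eq_empty {α : Type*} {N : CausalNet α} {c : Set α} (hc : N.IsCut c) :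
    N.prime c = ∅ := by
  refine Set.eq_empty_of_forall_notMem fun x hx => ?_
  have hins : (insert x c).Pairwise N.co :=
    hc.1.insert fun y hy _ => ⟨hx y hy, N.co_symm (hx y hy)⟩
  have hxc : x ∈ c := hc.2 _ hins (Set.subset_insert x c) ▸ Set.mem_insert x c
  exact N.not_co_self x (hx x hxc)

end CausalNet

/-- In a locally finite, K-dense causal net, the join of the
closed sets `{b}''` for `b` ranging over a B-cut `τ` is the whole carrier. -/
theorem bcut_atoms_join_univ {α : Type*} (N : CausalNet α)
    (hLF : N.LocallyFinite) (hK : N.KDense)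
    (τ : Set α) (hτ : N.IsCut τ) (hτB : τ ⊆ N.B) :
    N.prime (N.prime (⋃ b ∈ τ, N.prime (N.prime {b}))) = Set.univ := by
  have hsub : τ ⊆ ⋃ b ∈ τ, N.prime (N.prime {b}) := fun b hb =>
    Set.mem_biUnion hb (N.subset_prime_prime {b} rfl)
  have hempty : N.prime (⋃ b ∈ τ, N.prime (N.prime {b})) = ∅ :=
    Set.subset_empty_iff.1 ((N.prime_anti hsub).trans hτ.prime_eq_empty.subset)
  rw [hempty]
  exact Set.eq_univ_of_forall fun _ _ hy => hy.elim
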